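/- Let m = 2sh for positive integers s, h, and let ℓ be a positive integer with ℓ | 2^h + 1. Let γ be a primitive element of F_{2^m}. Then Σ_{x ∈ F_{2^m}} (-1)^{Tr(γ^i x^ℓ)} equals (-1)^s 2^{m/2} if i ≢ 0 (mod ℓ), and equals (-1)^{s-1}(ℓ-1) 2^{m/2} if i ≡ 0 (mod ℓ). -/

import Mathlib

open Finset
open scoped Classical

noncomputable instance (m : ℕ) : Fintype (GaloisField 2 m) := Fintype.ofFinite _

/-- Absolute trace from `GF(2^m)` to `F_2`. -/
noncomputable def Tr (m : ℕ) : GaloisField 2 m → ZMod 2 :=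
  Algebra.trace (ZMod 2) (GaloisField 2 m)

/-- Walsh transform `W_f(a,b) = Σ_x (-1)^{Tr(a f(x) + b x)}`. -/
noncomputable def Walsh (m : ℕ) (f : GaloisField 2 m → GaloisField 2 m)
    (a b : GaloisField 2 m) : ℤ :=
  ∑ x : GaloisField 2 m, (-1 : ℤ) ^ (Tr m (a * f x + b * x)).val

/-- Summing a function of period `M` over `L` periods. -/
theorem sum_range_mul_of_periodic {f : ℕ → ℤ} {M : ℕ} (hf : Function.Periodic f M) (L : ℕ) :
    ∑ j ∈ range (L * M), f j = L * ∑ j ∈ range M, f j := by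
  induction L with
  | zero => simp
  | succ L ih =>
    have hshift (j : ℕ) : f (L * M + j) = f j := by
      rw [add_comm, ← smul_eq_mul]
      exact hf.nsmul L j
    rw [Nat.succ_mul, sum_range_add, ih, Nat.cast_succ, add_mul, one_mul]
    simp only [hshift]

theorem map_pow_two_pow {F : Type*} [Field F] {ψ : AddChar F ℤ}
    (hfrob : ∀ x, ψ (x ^ 2) = ψ x) (h : ℕ) (x : F) : ψ (x ^ 2 ^ h) = ψ x := by
  induction h with
  | zero => simp
  | succ h ih => rw [pow_succ, pow_mul, hfrob, ih]

section PowSum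

variable {F : Type*} [Field F] [Fintype F]

theorem ne_zero_of_orderOf_eq {γ : F} (hγ : orderOf γ = Fintype.card F - 1) : γ ≠ 0 := by
  have : 1 < Fintype.card F := Fintype.one_lt_card
  rintro rfl
  rw [orderOf_zero] at hγ
  omega

theorem sum_eq_add_sum_range_pow {γ : F} (hγ : orderOf γ = Fintype.card F - 1) (f : F → ℤ) :
    ∑ x, f x = f 0 + ∑ j ∈ range (Fintype.card F - 1), f (γ ^ j) := by
  have hcard : 1 < Fintype.card F := Fintype.one_lt_card
  have hγ0 : γ ≠ 0 := ne_zero_of_orderOf_eq hγ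
  have hinj : Set.InjOn (fun j ↦ γ ^ j) (range (Fintype.card F - 1)) := by
    rw [← hγ]
    simpa [Set.Iio] using pow_injOn_Iio_orderOf (x := γ)
  have hnot : (0 : F) ∉ (range (Fintype.card F - 1)).image (fun j ↦ γ ^ j) := by
    simp [hγ0]
  have huniv : insert 0 ((range (Fintype.card F - 1)).image (fun j ↦ γ ^ j)) = univ := by
    rw [← card_eq_iff_eq_univ, card_insert_of_notMem hnot, card_image_of_injOn hinj, card_range]
    omega
  rw [← huniv, sum_insert hnot, sum_image hinj]

theorem exists_pow_eq_of_orderOf_eq {γ : F} (hγ : orderOf γ = Fintype.card F - 1) {x : F}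
    (hx : x ≠ 0) : ∃ j, γ ^ j = x := by
  by_contra! h
  have := sum_eq_add_sum_range_pow hγ (fun y ↦ if y = x then 1 else 0)
  simp [h, hx.symm] at this

/-- The exponential sum `∑ x, ψ (a * x ^ n)`. -/
def powSum (ψ : AddChar F ℤ) (n : ℕ) (a : F) : ℤ :=
  ∑ x, ψ (a * x ^ n)

variable (ψ : AddChar F ℤ)

theorem powSum_mul_pow {c : F} (hc : c ≠ 0) (n : ℕ) (a : F) :
    powSum ψ n (a * c ^ n) = powSum ψ n a := by
  refine Fintype.sum_bijective (c * ·) (mulLeft_bijective₀ c hc) _ _ fun x ↦ ?_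
  rw [mul_pow, mul_assoc]

theorem periodic_powSum {γ : F} (hγ : γ ≠ 0) (n : ℕ) :
    Function.Periodic (fun i ↦ powSum ψ n (γ ^ i)) n := fun i ↦ by
  simp only [pow_add, powSum_mul_pow ψ hγ]

theorem dvd_powSum_sub_one {γ : F} (hγ : orderOf γ = Fintype.card F - 1) {n : ℕ} (hn : 0 < n)
    (hdvd : n ∣ Fintype.card F - 1) (a : F) : (n : ℤ) ∣ powSum ψ n a - 1 := by
  obtain ⟨M, hM⟩ := hdvd
  have hper : Function.Periodic (fun j ↦ ψ (a * (γ ^ j) ^ n)) M := fun j ↦ by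
    have : γ ^ (M * n) = 1 := by rw [mul_comm, ← hM, ← hγ, pow_orderOf_eq_one]
    simp only [← pow_mul]
    rw [add_mul, pow_add, this, mul_one]
  rw [powSum, sum_eq_add_sum_range_pow hγ, hM, sum_range_mul_of_periodic hper]
  simp [hn.ne']

/-- Averaging the exponential sum of exponent `n * k` over `n`-th powers gives the exponential
sum of exponent `n`. -/
theorem sum_powSum_mul {γ : F} (hγ : orderOf γ = Fintype.card F - 1) {n k : ℕ} (hk : 0 < k)
    (hn : 0 < n) (a : F) :
    ∑ j ∈ range (Fintype.card F - 1), powSum ψ (n * k) (a * (γ ^ j) ^ n) =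
      (Fintype.card F - 1 : ℕ) * powSum ψ n a := by
  have h (x : F) (hx : x ≠ 0) :
      1 + ∑ j ∈ range (Fintype.card F - 1), ψ (a * (γ ^ j) ^ n * x ^ (n * k)) = powSum ψ n a := by
    rw [← powSum_mul_pow ψ (pow_ne_zero k hx), powSum, sum_eq_add_sum_range_pow hγ]
    simp only [zero_pow hn.ne', mul_zero, AddChar.map_zero_eq_one]
    congr! 3
    ring
  have h' (x : F) (hx : x ≠ 0) :
      ∑ j ∈ range (Fintype.card F - 1), ψ (a * (γ ^ j) ^ n * x ^ (n * k)) = powSum ψ n a - 1 := by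
    linarith [h x hx]
  have hγ0 : γ ≠ 0 := ne_zero_of_orderOf_eq hγ
  simp only [powSum]
  rw [sum_comm, sum_eq_add_sum_range_pow hγ, sum_congr rfl fun j _ ↦ h' _ (pow_ne_zero j hγ0)]
  simp [hn.ne', hk.ne', powSum]

theorem sum_powSum_eq_zero (hψ : ψ.IsPrimitive) {γ : F} (hγ : orderOf γ = Fintype.card F - 1)
    {n : ℕ} (hn : 0 < n) :
    ∑ j ∈ range (Fintype.card F - 1), powSum ψ n (γ ^ j) = 0 := by
  have htotal : ∑ a, powSum ψ n a = Fintype.card F := by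
    simp only [powSum]
    rw [sum_comm]
    simp [AddChar.sum_mulShift _ hψ, hn.ne']
  have hzero : powSum ψ n 0 = Fintype.card F := by simp [powSum]
  rw [sum_eq_add_sum_range_pow hγ, hzero] at htotal
  linarith

variable {ψ} [CharP F 2]

/-- The square of the quadratic exponential sum, as a sum over the radical of the form. -/
theorem powSum_two_pow_add_one_sq (hψ : ψ.IsPrimitive) (hfrob : ∀ x, ψ (x ^ 2) = ψ x) (h : ℕ)
    (a : F) :
    powSum ψ (2 ^ h + 1) a ^ 2 = ∑ z, if a * z + a ^ 2 ^ h * (z ^ 2 ^ h) ^ 2 ^ h = 0 then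
      Fintype.card F * ψ (a * z ^ (2 ^ h + 1)) else 0 := by
  have htwo : (2 : F) = 0 := CharTwo.two_eq_zero
  have hbij : Function.Bijective fun x : F ↦ x ^ 2 ^ h :=
    Finite.injective_iff_bijective.mp (iterateFrobenius F 2 h).injective
  have hexpand (x z : F) : ψ (a * x ^ (2 ^ h + 1)) * ψ (a * (x + z) ^ (2 ^ h + 1)) =
      ψ (a * z ^ (2 ^ h + 1)) * ψ (x ^ 2 ^ h * (a * z + a ^ 2 ^ h * (z ^ 2 ^ h) ^ 2 ^ h)) := by
    have hsplit : a * x ^ (2 ^ h + 1) + a * (x + z) ^ (2 ^ h + 1) =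
        a * z ^ (2 ^ h + 1) + (x ^ 2 ^ h * (a * z) + a * z ^ 2 ^ h * x) := by
      rw [pow_succ (x + z), add_pow_char_pow]
      linear_combination a * x ^ (2 ^ h + 1) * htwo
    rw [← AddChar.map_add_eq_mul, hsplit, AddChar.map_add_eq_mul, AddChar.map_add_eq_mul,
      ← map_pow_two_pow hfrob h (a * z ^ 2 ^ h * x), ← AddChar.map_add_eq_mul]
    congr 2
    ring
  calc powSum ψ (2 ^ h + 1) a ^ 2
      = ∑ x, ∑ y, ψ (a * x ^ (2 ^ h + 1)) * ψ (a * y ^ (2 ^ h + 1)) := by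
        rw [sq, powSum, sum_mul_sum]
    _ = ∑ x, ∑ z, ψ (a * x ^ (2 ^ h + 1)) * ψ (a * (x + z) ^ (2 ^ h + 1)) :=
        sum_congr rfl fun x _ ↦ (Equiv.sum_comp (Equiv.addLeft x)
          fun y ↦ ψ (a * x ^ (2 ^ h + 1)) * ψ (a * y ^ (2 ^ h + 1))).symm
    _ = _ := by
        rw [sum_comm]
        refine sum_congr rfl fun z _ ↦ ?_
        simp only [hexpand, ← mul_sum]
        rw [hbij.sum_comp fun y ↦ ψ (y * (a * z + a ^ 2 ^ h * (z ^ 2 ^ h) ^ 2 ^ h)),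
          AddChar.sum_mulShift _ hψ]
        split_ifs <;> simp [mul_comm]

theorem dvd_of_radical_ne_zero {γ : F} (hγ : orderOf γ = Fintype.card F - 1) {h i : ℕ}
    (hh : 0 < h) (hcard : 2 ^ h * 2 ^ h - 1 ∣ Fintype.card F - 1) {z : F} (hz : z ≠ 0)
    (hrad : γ ^ i * z + (γ ^ i) ^ 2 ^ h * (z ^ 2 ^ h) ^ 2 ^ h = 0) : 2 ^ h + 1 ∣ i := by
  obtain ⟨j, rfl⟩ := exists_pow_eq_of_orderOf_eq hγ hz
  have hγ0 : γ ≠ 0 := ne_zero_of_orderOf_eq hγ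
  obtain ⟨Q, hQ⟩ : ∃ Q, 2 ^ h = Q + 1 := ⟨2 ^ h - 1, by have := Nat.one_le_two_pow (n := h); omega⟩
  have hQ0 : 0 < Q := by
    have := Nat.one_lt_two_pow hh.ne'
    omega
  rw [hQ] at hrad hcard ⊢
  have hone : γ ^ ((i + (Q + 1 + 1) * j) * Q) = 1 := by
    have heq := CharTwo.add_eq_zero.mp hrad
    have hne : γ ^ (i + j) ≠ 0 := pow_ne_zero _ hγ0
    refine mul_left_cancel₀ hne ?_
    rw [mul_one, pow_add γ i j]
    nth_rw 2 [heq]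
    ring
  have hdvd : (Q + 1 + 1) * Q ∣ (i + (Q + 1 + 1) * j) * Q := by
    refine dvd_trans ?_ (orderOf_dvd_of_pow_eq_one hone)
    rw [hγ]
    rwa [show (Q + 1) * (Q + 1) = (Q + 1 + 1) * Q + 1 by ring, Nat.add_sub_cancel] at hcard
  exact (Nat.dvd_add_left (dvd_mul_right _ j)).mp (Nat.dvd_of_mul_dvd_mul_right hQ0 hdvd)

theorem two_pow_sq_sub_one_dvd (s h : ℕ) : 2 ^ h * 2 ^ h - 1 ∣ ((2 ^ h) ^ s) ^ 2 - 1 := by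
  have := Nat.sub_dvd_pow_sub_pow (2 ^ h * 2 ^ h) 1 s
  rwa [one_pow, mul_pow, ← sq ((2 ^ h) ^ s)] at this

theorem powSum_two_pow_add_one_of_not_dvd (hψ : ψ.IsPrimitive) (hfrob : ∀ x, ψ (x ^ 2) = ψ x)
    {s h : ℕ} (hh : 0 < h) (hcard : Fintype.card F = ((2 ^ h) ^ s) ^ 2) {γ : F}
    (hγ : orderOf γ = Fintype.card F - 1) {i : ℕ} (hi : ¬ 2 ^ h + 1 ∣ i) :
    powSum ψ (2 ^ h + 1) (γ ^ i) = (-1) ^ s * (2 ^ h) ^ s := by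
  have hdiv : 2 ^ h * 2 ^ h - 1 ∣ Fintype.card F - 1 := hcard ▸ two_pow_sq_sub_one_dvd s h
  have hsq : powSum ψ (2 ^ h + 1) (γ ^ i) ^ 2 = (((2 : ℤ) ^ h) ^ s) ^ 2 := by
    rw [powSum_two_pow_add_one_sq hψ hfrob, sum_eq_single 0]
    · simp [hcard]
    · intro z _ hz
      exact if_neg fun hrad ↦ hi (dvd_of_radical_ne_zero hγ hh hdiv hz hrad)
    · simp
  have hL : 2 ^ h + 1 ∣ Fintype.card F - 1 := by
    refine dvd_trans ⟨2 ^ h - 1, ?_⟩ hdiv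
    simpa using Nat.mul_self_sub_mul_self_eq (2 ^ h) 1
  have hmod := dvd_powSum_sub_one ψ hγ (Nat.succ_pos _) hL (γ ^ i)
  push_cast at hmod
  have hsign : (2 : ℤ) ^ h + 1 ∣ (2 ^ h) ^ s - (-1) ^ s := by
    simpa using sub_dvd_pow_sub_pow ((2 : ℤ) ^ h) (-1) s
  have hndvd : ¬ (2 : ℤ) ^ h + 1 ∣ 2 := fun hd ↦ by
    have := Int.le_of_dvd two_pos hd
    have : (2 : ℤ) ≤ 2 ^ h := le_self_pow₀ one_le_two hh.ne'
    omega
  rcases sq_eq_sq_iff_eq_or_eq_neg.mp hsq with hT | hT <;>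
    rcases neg_one_pow_eq_or ℤ s with hs | hs <;> rw [hs] at hsign ⊢ <;> rw [hT] at hmod ⊢
  · ring
  · have hd := dvd_sub hsign hmod
    rw [sub_sub_sub_cancel_left] at hd
    exact absurd hd hndvd
  · have hd := dvd_add hsign hmod
    rw [show ((2 : ℤ) ^ h) ^ s - 1 + (-(2 ^ h) ^ s - 1) = -2 by ring, dvd_neg] at hd
    exact absurd hd hndvd
  · ring

theorem powSum_of_dvd_two_pow_add_one (hψ : ψ.IsPrimitive) (hfrob : ∀ x, ψ (x ^ 2) = ψ x)
    {s h ℓ : ℕ} (hh : 0 < h) (hcard : Fintype.card F = ((2 ^ h) ^ s) ^ 2) {γ : F}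
    (hγ : orderOf γ = Fintype.card F - 1) (hℓ : ℓ ∣ 2 ^ h + 1) (i : ℕ) :
    powSum ψ ℓ (γ ^ i) =
      if i % ℓ = 0 then -((-1) ^ s * ((ℓ : ℤ) - 1) * (2 ^ h) ^ s) else (-1) ^ s * (2 ^ h) ^ s := by
  have hq : 0 < Fintype.card F - 1 := Nat.sub_pos_of_lt Fintype.one_lt_card
  have hγ0 : γ ≠ 0 := ne_zero_of_orderOf_eq hγ
  have hℓ0 : 0 < ℓ := Nat.pos_of_dvd_of_pos hℓ (Nat.succ_pos _)
  have hL : ℓ ∣ Fintype.card F - 1 := by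
    refine hℓ.trans (dvd_trans ⟨2 ^ h - 1, ?_⟩ (hcard ▸ two_pow_sq_sub_one_dvd s h))
    simpa using Nat.mul_self_sub_mul_self_eq (2 ^ h) 1
  have hnot {i : ℕ} (hi : ¬ ℓ ∣ i) : powSum ψ ℓ (γ ^ i) = (-1) ^ s * (2 ^ h) ^ s := by
    obtain ⟨k, hk⟩ := hℓ
    have hk0 : 0 < k := Nat.pos_of_ne_zero (by rintro rfl; simp at hk)
    have hterm (j : ℕ) : powSum ψ (ℓ * k) (γ ^ i * (γ ^ j) ^ ℓ) = (-1) ^ s * (2 ^ h) ^ s := by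
      rw [← pow_mul, ← pow_add, ← hk]
      refine powSum_two_pow_add_one_of_not_dvd hψ hfrob hh hcard hγ fun hd ↦ hi ?_
      exact (Nat.dvd_add_left (dvd_mul_left ℓ j)).mp ((Dvd.intro k hk.symm).trans hd)
    have havg := sum_powSum_mul ψ hγ hk0 hℓ0 (γ ^ i)
    simp only [hterm, sum_const, card_range, nsmul_eq_mul] at havg
    exact (mul_left_cancel₀ (by exact_mod_cast hq.ne') havg).symm
  split_ifs with hi
  · have hper := periodic_powSum ψ hγ0 ℓ
    obtain ⟨M, hM⟩ := hL
    have hsum := sum_powSum_eq_zero ψ hψ hγ hℓ0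
    rw [hM, mul_comm, sum_range_mul_of_periodic hper] at hsum
    have hM0 : (M : ℤ) ≠ 0 := by
      rintro hM0
      rw [hM, Nat.cast_eq_zero.mp hM0, mul_zero] at hq
      exact hq.false
    have hsum := (mul_eq_zero.mp hsum).resolve_left hM0
    obtain ⟨n, rfl⟩ : ∃ n, ℓ = n + 1 := ⟨ℓ - 1, by omega⟩
    rw [sum_range_succ', sum_congr rfl fun j hj ↦ hnot
      (Nat.not_dvd_of_pos_of_lt j.succ_pos (Nat.succ_lt_succ (mem_range.mp hj)))] at hsum
    have hzero := hper.map_mod_nat i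
    simp only [hi] at hzero
    rw [← hzero]
    simp only [sum_const, card_range, nsmul_eq_mul] at hsum
    push_cast
    linarith
  · exact hnot fun hd ↦ hi (Nat.mod_eq_zero_of_dvd hd)

end PowSum

/-- The canonical additive character `x ↦ (-1) ^ Tr x` of `GF(2^m)`. -/
noncomputable def trChar (m : ℕ) : AddChar (GaloisField 2 m) ℤ :=
  (AddChar.zmodChar 2 (ζ := (-1 : ℤ)) (by norm_num)).compAddMonoidHom
    (Algebra.trace (ZMod 2) (GaloisField 2 m)).toAddMonoidHom

theorem trChar_apply (m : ℕ) (x : GaloisField 2 m) : trChar m x = (-1) ^ (Tr m x).val := rfl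

theorem trChar_sq (m : ℕ) (x : GaloisField 2 m) : trChar m (x ^ 2) = trChar m x := by
  have := Algebra.trace_eq_of_algEquiv
    (FiniteField.frobeniusAlgEquivOfAlgebraic (ZMod 2) (GaloisField 2 m)) x
  rw [FiniteField.coe_frobeniusAlgEquivOfAlgebraic, ZMod.card] at this
  rw [trChar_apply, trChar_apply, Tr, this]

theorem isPrimitive_trChar (m : ℕ) : (trChar m).IsPrimitive := by
  intro a ha hone
  refine ha ((traceForm_nondegenerate (ZMod 2) (GaloisField 2 m)).1 a fun b ↦ ?_)
  have hb : trChar m (a * b) = 1 := by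
    rw [← AddChar.mulShift_apply, hone, AddChar.one_apply]
  rw [trChar_apply] at hb
  rw [Algebra.traceForm_apply]
  change Tr m (a * b) = 0
  generalize Tr m (a * b) = t at hb ⊢
  revert t
  decide

/-- Evaluation of the Gauss-type sum `Σ_x (-1)^{Tr(γ^i x^ℓ)}` for `m = 2sh`, `ℓ ∣ 2^h+1`. -/
theorem stmt12 (m s h ℓ : ℕ) (hs : 0 < s) (hh : 0 < h) (hm : m = 2 * s * h)
    (hℓ : 0 < ℓ) (hdvd : ℓ ∣ 2 ^ h + 1)
    (γ : GaloisField 2 m) (hγ : orderOf γ = 2 ^ m - 1) (i : ℕ) :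
    ∑ x : GaloisField 2 m, (-1 : ℤ) ^ (Tr m (γ ^ i * x ^ ℓ)).val
      = if i % ℓ = 0 then (-1 : ℤ) ^ (s - 1) * ((ℓ : ℤ) - 1) * 2 ^ (m / 2)
        else (-1 : ℤ) ^ s * 2 ^ (m / 2) := by
  have hcard : Fintype.card (GaloisField 2 m) = ((2 ^ h) ^ s) ^ 2 := by
    rw [← Nat.card_eq_fintype_card, GaloisField.card 2 m (by rw [hm]; positivity), hm]
    ring
  have hcard' : Fintype.card (GaloisField 2 m) = 2 ^ m := by
    rw [hcard, hm]
    ring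
  have hpow : (2 : ℤ) ^ (m / 2) = (2 ^ h) ^ s := by
    rw [hm, mul_assoc, Nat.mul_div_cancel_left _ two_pos, ← pow_mul, mul_comm]
  have hsum := powSum_of_dvd_two_pow_add_one (isPrimitive_trChar m) (trChar_sq m) hh hcard
    (by rw [hγ, hcard']) hdvd i
  simp only [powSum, trChar_apply] at hsum
  rw [hsum, hpow]
  obtain ⟨t, rfl⟩ : ∃ t, s = t + 1 := ⟨s - 1, by omega⟩
  rw [Nat.add_sub_cancel]
  split_ifs <;> ring
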